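/- (Lipschitz bound of the multi-layer structure-aware Transformer, explicit-constant form.) Let X ∈ ℝ^{n×d} be input features and A ∈ {0,1}^{n×n} a binary mask matrix. Consider an L-layer structure-aware Transformer: H^{(0)} = X and H^{(ℓ+1)}_i = f_ℓ(Attn_i^{(ℓ)} + H^{(ℓ)}_i), where each f_ℓ : ℝ^d → ℝ^d is L_ℓ-Lipschitz, Attn_i^{(ℓ)} = Σ_{v=1}^{n} ᾱ^{(ℓ)}_{iv} H^{(ℓ)}_v, and the weight vectors satisfy ᾱ^{(ℓ)}_{iv} = 0 whenever A_{iv} = 0. Then for all nodes i, j: ‖H^{(L)}_i − H^{(L)}_j‖_2 ≤ (Π_{ℓ=0}^{L−1} L_ℓ) · ‖X_i − X_j‖_2 + Σ_{ℓ=0}^{L−1} (Π_{m=ℓ}^{L−1} L_m) · ( ‖ᾱ^{(ℓ)}_i − ᾱ^{(ℓ)}_j‖_1 + ‖A_i − A_j‖_1 ) · max_v ‖H^{(ℓ)}_v‖_2. -/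

import Mathlib

open Matrix

/-- The Euclidean (ℓ2) norm of a vector in `ℝ^d`. -/
noncomputable def l2norm {d : ℕ} (x : Fin d → ℝ) : ℝ :=
  Real.sqrt (∑ i, (x i) ^ 2)

/-- The ℓ1 norm of a vector in `ℝ^d`. -/
def l1norm {d : ℕ} (x : Fin d → ℝ) : ℝ :=
  ∑ i, |x i|

theorem l2norm_eq_norm_toLp {d : ℕ} (x : Fin d → ℝ) : l2norm x = ‖WithLp.toLp 2 x‖ := by
  simp [l2norm, EuclideanSpace.norm_eq]

theorem l2norm_add_le {d : ℕ} (x y : Fin d → ℝ) : l2norm (x + y) ≤ l2norm x + l2norm y := by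
  simpa only [l2norm_eq_norm_toLp, WithLp.toLp_add] using norm_add_le _ _

theorem l1norm_nonneg {d : ℕ} (x : Fin d → ℝ) : 0 ≤ l1norm x :=
  Finset.sum_nonneg fun _ _ => abs_nonneg _

theorem l2norm_sum_smul_le {n d : ℕ} (c : Fin n → ℝ) (M : Fin n → Fin d → ℝ) :
    l2norm (∑ v, c v • M v) ≤ l1norm c * ⨆ v, l2norm (M v) := by
  rw [l2norm_eq_norm_toLp, WithLp.toLp_sum, l1norm, Finset.sum_mul]
  refine (norm_sum_le _ _).trans (Finset.sum_le_sum fun v _ => ?_)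
  rw [WithLp.toLp_smul, norm_smul, Real.norm_eq_abs, ← l2norm_eq_norm_toLp]
  exact mul_le_mul_of_nonneg_left
    (le_ciSup (f := fun v => l2norm (M v)) (Set.finite_range _).bddAbove v) (abs_nonneg _)

theorem l2norm_layer_sub_le {n d : ℕ} (a b : Fin n → ℝ) (M : Fin n → Fin d → ℝ)
    (x y : Fin d → ℝ) :
    l2norm ((∑ v, a v • M v + x) - (∑ v, b v • M v + y)) ≤
      l2norm (x - y) + l1norm (a - b) * ⨆ v, l2norm (M v) := by
  have h : (∑ v, a v • M v + x) - (∑ v, b v • M v + y) =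
      (x - y) + ∑ v, (a - b) v • M v := by
    simp only [Pi.sub_apply, sub_smul, Finset.sum_sub_distrib]
    abel
  rw [h]
  exact (l2norm_add_le _ _).trans (add_le_add_right (l2norm_sum_smul_le _ _) _)

/-- **Lipschitz bound of the multi-layer structure-aware Transformer**
(explicit-constant form). For the `L`-layer network `H⁽⁰⁾ = X`,
`H⁽ˡ⁺¹⁾_i = f_ℓ (Attn⁽ˡ⁾_i + H⁽ˡ⁾_i)` with `L_ℓ`-Lipschitz MLPs `f_ℓ` and masked attention
weights `ᾱ⁽ˡ⁾` supported on the binary mask `A`, the output gap of two nodes is bounded by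
the input feature gap, the attention-weight gaps, and the adjacency-row gaps. -/
theorem multilayer_structure_aware_transformer_lipschitz (n d L : ℕ)
    (X : Matrix (Fin n) (Fin d) ℝ)
    (A : Matrix (Fin n) (Fin n) ℝ)
    (hbin : ∀ i v, A i v = 0 ∨ A i v = 1)
    (ᾱ : ℕ → Matrix (Fin n) (Fin n) ℝ)
    (hsupp : ∀ ℓ i v, A i v = 0 → ᾱ ℓ i v = 0)
    (H : ℕ → Matrix (Fin n) (Fin d) ℝ)
    (Attn : ℕ → Matrix (Fin n) (Fin d) ℝ)
    (hAttn : ∀ ℓ i, Attn ℓ i = ∑ v, ᾱ ℓ i v • H ℓ v)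
    (K : ℕ → ℝ) (hK : ∀ ℓ, 0 ≤ K ℓ)
    (f : ℕ → (Fin d → ℝ) → (Fin d → ℝ))
    (hf : ∀ ℓ x y, l2norm (f ℓ x - f ℓ y) ≤ K ℓ * l2norm (x - y))
    (hH0 : H 0 = X)
    (hrec : ∀ ℓ i, H (ℓ + 1) i = f ℓ (Attn ℓ i + H ℓ i))
    (i j : Fin n) :
    l2norm (H L i - H L j) ≤
      (∏ ℓ ∈ Finset.range L, K ℓ) * l2norm (X i - X j) +
        ∑ ℓ ∈ Finset.range L, (∏ m ∈ Finset.Ico ℓ L, K m) *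
          ((l1norm (ᾱ ℓ i - ᾱ ℓ j) + l1norm (A i - A j)) * ⨆ v, l2norm (H ℓ v)) := by
  induction L with
  | zero => simp [hH0]
  | succ L ih =>
    have hsup : 0 ≤ ⨆ v, l2norm (H L v) := Real.iSup_nonneg fun v => Real.sqrt_nonneg _
    have hlayer := l2norm_layer_sub_le (ᾱ L i) (ᾱ L j) (H L) (H L i) (H L j)
    have hmask : l1norm (ᾱ L i - ᾱ L j) * (⨆ v, l2norm (H L v)) ≤
        (l1norm (ᾱ L i - ᾱ L j) + l1norm (A i - A j)) * ⨆ v, l2norm (H L v) :=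
      mul_le_mul_of_nonneg_right (le_add_of_nonneg_right (l1norm_nonneg _)) hsup
    have hsum : ∑ ℓ ∈ Finset.range L, (∏ m ∈ Finset.Ico ℓ (L + 1), K m) *
          ((l1norm (ᾱ ℓ i - ᾱ ℓ j) + l1norm (A i - A j)) * ⨆ v, l2norm (H ℓ v)) =
        K L * ∑ ℓ ∈ Finset.range L, (∏ m ∈ Finset.Ico ℓ L, K m) *
          ((l1norm (ᾱ ℓ i - ᾱ ℓ j) + l1norm (A i - A j)) * ⨆ v, l2norm (H ℓ v)) := by
      rw [Finset.mul_sum]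
      refine Finset.sum_congr rfl fun ℓ hℓ => ?_
      rw [Finset.prod_Ico_succ_top (Finset.mem_range.mp hℓ).le]
      ring
    rw [hrec, hrec, hAttn, hAttn, Finset.prod_range_succ, Finset.sum_range_succ, hsum,
      Nat.Ico_succ_singleton, Finset.prod_singleton]
    refine (hf L _ _).trans ((mul_le_mul_of_nonneg_left
      (hlayer.trans (add_le_add ih hmask)) (hK L)).trans_eq ?_)
    ring
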